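/- Let n1, n2 ≥ 0 be integers and let I ⊆ ℝ be an interval symmetric about 0. Suppose α = (α1, α2) : I → ℂ² is differentiable, α(0) ∈ ℝ², and for j = 1, 2 and all t ∈ I: α_j'(t)·conj(α_j(t)) = i·conj(α1(t))^{n1+1}·conj(α2(t))^{n2+1}. Then the curve δ = (δ1, δ2) : I → ℂ² defined by δ_j(t) = conj(α_j(−t)) is differentiable, satisfies δ(0) = α(0), and satisfies the same system: δ_j'(t)·conj(δ_j(t)) = i·conj(δ1(t))^{n1+1}·conj(δ2(t))^{n2+1} for all t ∈ I and j = 1, 2. -/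

import Mathlib

theorem HasDerivWithinAt.conj_comp_neg {I : Set ℝ} (hsym : ∀ t ∈ I, -t ∈ I) {f g : ℝ → ℂ}
    {f' : ℂ} {t : ℝ} (hf : HasDerivWithinAt f f' I (-t))
    (hg : ∀ s, g s = (starRingEnd ℂ) (f (-s))) :
    HasDerivWithinAt g (-(starRingEnd ℂ) f') I t := by
  have h := (hf.scomp t (hasDerivWithinAt_neg t I) hsym).star
  have hfun : g = fun s => star ((f ∘ Neg.neg) s) := funext hg
  rw [hfun]
  simpa using h

theorem neg_conj_mul_of_mul_conj_eq {a x y z : ℂ} {m n : ℕ}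
    (h : a * (starRingEnd ℂ) z
      = Complex.I * ((starRingEnd ℂ) x) ^ m * ((starRingEnd ℂ) y) ^ n) :
    -(starRingEnd ℂ) a * z = Complex.I * x ^ m * y ^ n := by
  have h' := congrArg (starRingEnd ℂ) h
  simp only [map_mul, map_pow, Complex.conj_conj, Complex.conj_I] at h'
  linear_combination -h'


/-- if `α` solves the ODE
`α_j'·conj α_j = i·conj(α1)^{n1+1}·conj(α2)^{n2+1}` on an interval symmetric about `0`
with `α(0) ∈ ℝ²`, then `δ_j(t) = conj(α_j(−t))` is differentiable, has the same initial
value, and solves the same ODE. -/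
theorem stmt_15 (n1 n2 : ℕ) (I : Set ℝ) (hsym : ∀ t ∈ I, -t ∈ I)
    (α1 α2 α1' α2' : ℝ → ℂ)
    (hd1 : ∀ t ∈ I, HasDerivWithinAt α1 (α1' t) I t)
    (hd2 : ∀ t ∈ I, HasDerivWithinAt α2 (α2' t) I t)
    (hreal1 : (α1 0).im = 0) (hreal2 : (α2 0).im = 0)
    (hode1 : ∀ t ∈ I,
      α1' t * (starRingEnd ℂ) (α1 t)
        = Complex.I * ((starRingEnd ℂ) (α1 t)) ^ (n1 + 1) * ((starRingEnd ℂ) (α2 t)) ^ (n2 + 1))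
    (hode2 : ∀ t ∈ I,
      α2' t * (starRingEnd ℂ) (α2 t)
        = Complex.I * ((starRingEnd ℂ) (α1 t)) ^ (n1 + 1) * ((starRingEnd ℂ) (α2 t)) ^ (n2 + 1))
    (δ1 δ2 : ℝ → ℂ)
    (hδ1 : ∀ t, δ1 t = (starRingEnd ℂ) (α1 (-t)))
    (hδ2 : ∀ t, δ2 t = (starRingEnd ℂ) (α2 (-t))) :
    (δ1 0 = α1 0 ∧ δ2 0 = α2 0) ∧
    ∃ δ1' δ2' : ℝ → ℂ,
      (∀ t ∈ I, HasDerivWithinAt δ1 (δ1' t) I t) ∧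
      (∀ t ∈ I, HasDerivWithinAt δ2 (δ2' t) I t) ∧
      (∀ t ∈ I,
        δ1' t * (starRingEnd ℂ) (δ1 t)
          = Complex.I * ((starRingEnd ℂ) (δ1 t)) ^ (n1 + 1) * ((starRingEnd ℂ) (δ2 t)) ^ (n2 + 1)) ∧
      (∀ t ∈ I,
        δ2' t * (starRingEnd ℂ) (δ2 t)
          = Complex.I * ((starRingEnd ℂ) (δ1 t)) ^ (n1 + 1) * ((starRingEnd ℂ) (δ2 t)) ^ (n2 + 1)) := by
  refine ⟨⟨?_, ?_⟩, fun t => -(starRingEnd ℂ) (α1' (-t)), fun t => -(starRingEnd ℂ) (α2' (-t)),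
    fun t ht => (hd1 _ (hsym t ht)).conj_comp_neg hsym hδ1,
    fun t ht => (hd2 _ (hsym t ht)).conj_comp_neg hsym hδ2, fun t ht => ?_, fun t ht => ?_⟩
  · rw [hδ1, neg_zero, Complex.conj_eq_iff_im.2 hreal1]
  · rw [hδ2, neg_zero, Complex.conj_eq_iff_im.2 hreal2]
  · simpa only [hδ1, hδ2, Complex.conj_conj] using
      neg_conj_mul_of_mul_conj_eq (hode1 _ (hsym t ht))
  · simpa only [hδ1, hδ2, Complex.conj_conj] using
      neg_conj_mul_of_mul_conj_eq (hode2 _ (hsym t ht))
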